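/- Let E be a finite-dimensional spectral COSEA, b∈E and ω∈Ω(E). Then b is dispersion-free relative to ω (i.e. ω(b∘b)=ω(b)²) if and only if b is constant almost everywhere with respect to ω, i.e. there exist λ∈[0,1], a∈S(E) and c∈E with b=λa⊕c, a∘c=0 and ω(a)=1. -/

import Mathlib

set_option linter.unusedVariables false

universe u v

theorem prod_eq' {α β : Type*} {p q : α × β} (h1 : p.1 = q.1) (h2 : p.2 = q.2) : p = q :=
  Prod.ext_iff.mpr ⟨h1, h2⟩

/-- A convex sequential effect algebra (COSEA).  The partial sum `⊕` is modelled by a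
total operation `oplus` together with a definedness predicate `perp`; all axioms only
constrain `oplus` on pairs satisfying `perp`.  The scalar action is modelled by a total
map `smul : ℝ → E → E`, with axioms imposed for scalars in `[0,1]`. -/
structure COSEA (E : Type u) where
  zero : E
  one : E
  perp : E → E → Prop
  oplus : E → E → E
  compl : E → E
  smul : ℝ → E → E
  seq : E → E → E
  -- effect algebra axioms
  perp_comm : ∀ a b, perp a b → perp b a
  oplus_comm : ∀ a b, perp a b → oplus a b = oplus b a
  perp_assoc_right : ∀ a b c, perp a b → perp (oplus a b) c → perp b c
  perp_assoc_left : ∀ a b c, perp a b → perp (oplus a b) c → perp a (oplus b c)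
  oplus_assoc : ∀ a b c, perp a b → perp (oplus a b) c →
    oplus a (oplus b c) = oplus (oplus a b) c
  perp_compl : ∀ a, perp a (compl a)
  oplus_compl : ∀ a, oplus a (compl a) = one
  compl_unique : ∀ a b, perp a b → oplus a b = one → b = compl a
  perp_one : ∀ a, perp a one → a = zero
  -- convexity axioms
  smul_smul : ∀ α β a, 0 ≤ α → α ≤ 1 → 0 ≤ β → β ≤ 1 →
    smul α (smul β a) = smul (α * β) a
  perp_smul_self : ∀ α β a, 0 ≤ α → 0 ≤ β → α + β ≤ 1 → perp (smul α a) (smul β a)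
  add_smul : ∀ α β a, 0 ≤ α → 0 ≤ β → α + β ≤ 1 →
    smul (α + β) a = oplus (smul α a) (smul β a)
  perp_smul : ∀ lam a b, 0 ≤ lam → lam ≤ 1 → perp a b → perp (smul lam a) (smul lam b)
  smul_oplus : ∀ lam a b, 0 ≤ lam → lam ≤ 1 → perp a b →
    smul lam (oplus a b) = oplus (smul lam a) (smul lam b)
  one_smul : ∀ a, smul 1 a = a
  -- sequential product axioms
  seq_perp : ∀ a b c, perp b c → perp (seq a b) (seq a c)
  seq_oplus : ∀ a b c, perp b c → seq a (oplus b c) = oplus (seq a b) (seq a c)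
  one_seq : ∀ a, seq one a = a
  seq_eq_zero_comm : ∀ a b, seq a b = zero → seq b a = seq a b
  comm_compl : ∀ a b, seq a b = seq b a → seq a (compl b) = seq (compl b) a
  comm_assoc : ∀ a b c, seq a b = seq b a → seq a (seq b c) = seq (seq a b) c
  comm_seq : ∀ a b c, seq c a = seq a c → seq c b = seq b c →
    seq c (seq a b) = seq (seq a b) c
  comm_oplus : ∀ a b c, seq c a = seq a c → seq c b = seq b c → perp a b →
    seq c (oplus a b) = seq (oplus a b) c
  smul_seq : ∀ lam a b, 0 ≤ lam → lam ≤ 1 → seq (smul lam a) b = smul lam (seq a b)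
  seq_smul : ∀ lam a b, 0 ≤ lam → lam ≤ 1 → seq a (smul lam b) = smul lam (seq a b)

/-- `SumList C l s` : the orthogonal sum of the list `l` is defined and equals `s`. -/
inductive COSEA.SumList {E : Type u} (C : COSEA E) : List E → E → Prop
  | nil : COSEA.SumList C [] C.zero
  | cons {a : E} {l : List E} {s : E} :
      COSEA.SumList C l s → C.perp a s → COSEA.SumList C (a :: l) (C.oplus a s)

namespace COSEA

variable {E : Type u}

/-- `a ≤ b` in the effect-algebra order. -/
def le (C : COSEA E) (a b : E) : Prop := ∃ c, C.perp a c ∧ C.oplus a c = b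

/-- `a` is sharp: the greatest lower bound of `a` and `a'` is `0`,
i.e. every common lower bound of `a` and `a'` lies below `0`. -/
def IsSharp (C : COSEA E) (a : E) : Prop :=
  ∀ c, C.le c a → C.le c (C.compl a) → C.le c C.zero

/-- `a` is a one-dimensional (atomic) sharp element. -/
def IsOneDim (C : COSEA E) (a : E) : Prop :=
  C.IsSharp a ∧ a ≠ C.zero ∧
    ∀ b, C.le b a → ∃ lam : ℝ, 0 ≤ lam ∧ lam ≤ 1 ∧ b = C.smul lam a

/-- A state on a COSEA. -/
def IsState (C : COSEA E) (ω : E → ℝ) : Prop :=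
  (∀ a, 0 ≤ ω a ∧ ω a ≤ 1) ∧ ω C.one = 1 ∧
    ∀ a b, C.perp a b → ω (C.oplus a b) = ω a + ω b

/-- A context presented as an injective finite enumeration of one-dimensional
elements summing to `1`. -/
def IsContextFun (C : COSEA E) {n : ℕ} (a : Fin n → E) : Prop :=
  Function.Injective a ∧ (∀ i, C.IsOneDim (a i)) ∧ C.SumList (List.ofFn a) C.one

/-- A context as a set of effects. -/
def IsContext (C : COSEA E) (A : Set E) : Prop :=
  ∃ (n : ℕ) (a : Fin n → E), C.IsContextFun a ∧ Set.range a = A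

/-- `E` is finite-dimensional: there is no infinite sequence of one-dimensional
elements all of whose initial partial orthogonal sums are defined. -/
def FinDim (C : COSEA E) : Prop :=
  ¬ ∃ f : ℕ → E, (∀ i, C.IsOneDim (f i)) ∧
      ∀ n : ℕ, ∃ s, C.SumList ((List.range n).map f) s

/-- `E` is state-unique. -/
def StateUnique (C : COSEA E) : Prop :=
  ∀ a, C.IsOneDim a → ∃! ω : E → ℝ, C.IsState ω ∧ ω a = 1

/-- `E` is symmetric : `â(b) = b̂(a)` for all one-dimensional `a, b`. -/
def Symm (C : COSEA E) : Prop :=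
  ∀ a b ω ρ, C.IsOneDim a → C.IsOneDim b → C.IsState ω → C.IsState ρ →
    ω a = 1 → ρ b = 1 → ω b = ρ a

/-- `b = λ₁ a₁ ⊕ ⋯ ⊕ λₙ aₙ` with all `λ i ∈ [0,1]`. -/
def SpanRep (C : COSEA E) {n : ℕ} (a : Fin n → E) (lam : Fin n → ℝ) (b : E) : Prop :=
  (∀ i, 0 ≤ lam i ∧ lam i ≤ 1) ∧
    C.SumList (List.ofFn fun i => C.smul (lam i) (a i)) b

/-- `b ∈ E(A)` : `b` has a representation over the context `A`. -/
def InSpan (C : COSEA E) (A : Set E) (b : E) : Prop :=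
  ∃ (n : ℕ) (a : Fin n → E) (lam : Fin n → ℝ),
    C.IsContextFun a ∧ Set.range a = A ∧ C.SpanRep a lam b

/-- `E` is spectral. -/
def Spectral (C : COSEA E) : Prop :=
  C.StateUnique ∧ ∀ b, ∃ A, C.IsContext A ∧ C.InSpan A b

/-- The commutant of a subset. -/
def commutant (C : COSEA E) (F : Set E) : Set E :=
  {b | ∀ a ∈ F, C.seq b a = C.seq a b}

/-- The center `E' = {b : b ∘ a = a ∘ b for all a}`. -/
def center (C : COSEA E) : Set E := C.commutant Set.univ

/-- `E` is a factor: the center consists of the effects `λ 1`, `λ ∈ [0,1]`. -/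
def IsFactor (C : COSEA E) : Prop :=
  C.center = {b | ∃ lam : ℝ, 0 ≤ lam ∧ lam ≤ 1 ∧ b = C.smul lam C.one}

/-- Sub-COSEA. -/
def IsSubCOSEA (C : COSEA E) (F : Set E) : Prop :=
  C.zero ∈ F ∧ C.one ∈ F ∧ (∀ a ∈ F, C.compl a ∈ F) ∧
    (∀ lam : ℝ, 0 ≤ lam → lam ≤ 1 → ∀ a ∈ F, C.smul lam a ∈ F) ∧
    (∀ a ∈ F, ∀ b ∈ F, C.perp a b → C.oplus a b ∈ F) ∧
    (∀ a ∈ F, ∀ b ∈ F, C.seq a b ∈ F)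

/-- `a` is a minimal sharp element of `F`. -/
def MinSharp (C : COSEA E) (F : Set E) (a : E) : Prop :=
  a ∈ F ∧ C.IsSharp a ∧ a ≠ C.zero ∧
    ∀ b ∈ F, C.IsSharp b → b ≠ C.zero → C.le b a → b = a

/-- COSEA isomorphism. -/
def IsIso {F : Type u} (C : COSEA E) (D : COSEA F) (φ : E → F) : Prop :=
  Function.Bijective φ ∧ φ C.one = D.one ∧
    (∀ a b, C.perp a b ↔ D.perp (φ a) (φ b)) ∧
    (∀ a b, C.perp a b → φ (C.oplus a b) = D.oplus (φ a) (φ b)) ∧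
    (∀ lam : ℝ, 0 ≤ lam → lam ≤ 1 → ∀ a, φ (C.smul lam a) = D.smul lam (φ a)) ∧
    (∀ a b, φ (C.seq a b) = D.seq (φ a) (φ b))

/-- `lam` is an eigenvalue of `b` : `lam = â(b)` for some eigeneffect `a` of `b`. -/
def IsEigenvalue (C : COSEA E) (b : E) (lam : ℝ) : Prop :=
  ∃ (a : E) (ω : E → ℝ), C.IsOneDim a ∧ C.seq a b = C.seq b a ∧
    C.IsState ω ∧ ω a = 1 ∧ lam = ω b

/-- The spectrum of `b`. -/
def spectrum (C : COSEA E) (b : E) : Set ℝ := {lam | C.IsEigenvalue b lam}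

/-- `c = ⌈a⌉` : `c` is the least sharp element dominating `a`. -/
def IsCeil (C : COSEA E) (a c : E) : Prop :=
  C.IsSharp c ∧ C.le a c ∧ ∀ d, C.IsSharp d → C.le a d → C.le c d

/-- `b` is a pseudo-inverse of `a` with scalar `lam` :
`⌈b⌉ = ⌈a⌉`, `‖b‖ = 1` and `a ∘ b = b ∘ a = lam ⌈a⌉`. -/
def IsPseudoInvWith (C : COSEA E) (a b : E) (lam : ℝ) : Prop :=
  (∃ ca, C.IsCeil a ca ∧ C.IsCeil b ca ∧
    C.seq a b = C.smul lam ca ∧ C.seq b a = C.smul lam ca) ∧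
  IsGreatest (C.spectrum b) 1 ∧ 0 ≤ lam ∧ lam ≤ 1

/-- The conditional probability map `γ_a` (zero functionals are sent to `0`). -/
noncomputable def condProb (C : COSEA E) (a : E) (ω : E → ℝ) : E → ℝ :=
  fun c => if ω a = 0 then 0 else ω (C.seq a c) / ω a

/-- Membership in `Ω̂(E) = Ω(E) ∪ {0}`. -/
def InOmegaHat (C : COSEA E) (ω : E → ℝ) : Prop :=
  C.IsState ω ∨ ω = fun _ => 0

/-- Direct sum of two COSEAs, with all operations componentwise. -/
def prod {E F : Type u} (C : COSEA E) (D : COSEA F) : COSEA (E × F) where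
  zero := (C.zero, D.zero)
  one := (C.one, D.one)
  perp a b := C.perp a.1 b.1 ∧ D.perp a.2 b.2
  oplus a b := (C.oplus a.1 b.1, D.oplus a.2 b.2)
  compl a := (C.compl a.1, D.compl a.2)
  smul lam a := (C.smul lam a.1, D.smul lam a.2)
  seq a b := (C.seq a.1 b.1, D.seq a.2 b.2)
  perp_comm := fun a b h => ⟨C.perp_comm _ _ h.1, D.perp_comm _ _ h.2⟩
  oplus_comm := fun a b h => prod_eq' (C.oplus_comm _ _ h.1) (D.oplus_comm _ _ h.2)
  perp_assoc_right := fun a b c h1 h2 =>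
    ⟨C.perp_assoc_right _ _ _ h1.1 h2.1, D.perp_assoc_right _ _ _ h1.2 h2.2⟩
  perp_assoc_left := fun a b c h1 h2 =>
    ⟨C.perp_assoc_left _ _ _ h1.1 h2.1, D.perp_assoc_left _ _ _ h1.2 h2.2⟩
  oplus_assoc := fun a b c h1 h2 =>
    prod_eq' (C.oplus_assoc _ _ _ h1.1 h2.1) (D.oplus_assoc _ _ _ h1.2 h2.2)
  perp_compl := fun a => ⟨C.perp_compl _, D.perp_compl _⟩
  oplus_compl := fun a => prod_eq' (C.oplus_compl _) (D.oplus_compl _)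
  compl_unique := fun a b h he =>
    prod_eq' (C.compl_unique _ _ h.1 (congrArg Prod.fst he))
      (D.compl_unique _ _ h.2 (congrArg Prod.snd he))
  perp_one := fun a h => prod_eq' (C.perp_one _ h.1) (D.perp_one _ h.2)
  smul_smul := fun α β a h1 h2 h3 h4 =>
    prod_eq' (C.smul_smul _ _ _ h1 h2 h3 h4) (D.smul_smul _ _ _ h1 h2 h3 h4)
  perp_smul_self := fun α β a h1 h2 h3 =>
    ⟨C.perp_smul_self _ _ _ h1 h2 h3, D.perp_smul_self _ _ _ h1 h2 h3⟩
  add_smul := fun α β a h1 h2 h3 =>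
    prod_eq' (C.add_smul _ _ _ h1 h2 h3) (D.add_smul _ _ _ h1 h2 h3)
  perp_smul := fun lam a b h1 h2 h =>
    ⟨C.perp_smul _ _ _ h1 h2 h.1, D.perp_smul _ _ _ h1 h2 h.2⟩
  smul_oplus := fun lam a b h1 h2 h =>
    prod_eq' (C.smul_oplus _ _ _ h1 h2 h.1) (D.smul_oplus _ _ _ h1 h2 h.2)
  one_smul := fun a => prod_eq' (C.one_smul _) (D.one_smul _)
  seq_perp := fun a b c h => ⟨C.seq_perp _ _ _ h.1, D.seq_perp _ _ _ h.2⟩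
  seq_oplus := fun a b c h => prod_eq' (C.seq_oplus _ _ _ h.1) (D.seq_oplus _ _ _ h.2)
  one_seq := fun a => prod_eq' (C.one_seq _) (D.one_seq _)
  seq_eq_zero_comm := fun a b h =>
    prod_eq' (C.seq_eq_zero_comm _ _ (congrArg Prod.fst h))
      (D.seq_eq_zero_comm _ _ (congrArg Prod.snd h))
  comm_compl := fun a b h =>
    prod_eq' (C.comm_compl _ _ (congrArg Prod.fst h))
      (D.comm_compl _ _ (congrArg Prod.snd h))
  comm_assoc := fun a b c h =>
    prod_eq' (C.comm_assoc _ _ _ (congrArg Prod.fst h))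
      (D.comm_assoc _ _ _ (congrArg Prod.snd h))
  comm_seq := fun a b c h1 h2 =>
    prod_eq' (C.comm_seq _ _ _ (congrArg Prod.fst h1) (congrArg Prod.fst h2))
      (D.comm_seq _ _ _ (congrArg Prod.snd h1) (congrArg Prod.snd h2))
  comm_oplus := fun a b c h1 h2 hp =>
    prod_eq' (C.comm_oplus _ _ _ (congrArg Prod.fst h1) (congrArg Prod.fst h2) hp.1)
      (D.comm_oplus _ _ _ (congrArg Prod.snd h1) (congrArg Prod.snd h2) hp.2)
  smul_seq := fun lam a b h1 h2 =>
    prod_eq' (C.smul_seq _ _ _ h1 h2) (D.smul_seq _ _ _ h1 h2)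
  seq_smul := fun lam a b h1 h2 =>
    prod_eq' (C.seq_smul _ _ _ h1 h2) (D.seq_smul _ _ _ h1 h2)

/-- Direct sum of a family of COSEAs, with all operations componentwise. -/
def pi {ι : Type v} {E : ι → Type u} (C : ∀ i, COSEA (E i)) : COSEA (∀ i, E i) where
  zero := fun i => (C i).zero
  one := fun i => (C i).one
  perp a b := ∀ i, (C i).perp (a i) (b i)
  oplus a b := fun i => (C i).oplus (a i) (b i)
  compl a := fun i => (C i).compl (a i)
  smul lam a := fun i => (C i).smul lam (a i)
  seq a b := fun i => (C i).seq (a i) (b i)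
  perp_comm := fun a b h i => (C i).perp_comm _ _ (h i)
  oplus_comm := fun a b h => funext fun i => (C i).oplus_comm _ _ (h i)
  perp_assoc_right := fun a b c h1 h2 i => (C i).perp_assoc_right _ _ _ (h1 i) (h2 i)
  perp_assoc_left := fun a b c h1 h2 i => (C i).perp_assoc_left _ _ _ (h1 i) (h2 i)
  oplus_assoc := fun a b c h1 h2 => funext fun i => (C i).oplus_assoc _ _ _ (h1 i) (h2 i)
  perp_compl := fun a i => (C i).perp_compl _
  oplus_compl := fun a => funext fun i => (C i).oplus_compl _
  compl_unique := fun a b h he =>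
    funext fun i => (C i).compl_unique _ _ (h i) (congrFun he i)
  perp_one := fun a h => funext fun i => (C i).perp_one _ (h i)
  smul_smul := fun α β a h1 h2 h3 h4 =>
    funext fun i => (C i).smul_smul _ _ _ h1 h2 h3 h4
  perp_smul_self := fun α β a h1 h2 h3 i => (C i).perp_smul_self _ _ _ h1 h2 h3
  add_smul := fun α β a h1 h2 h3 => funext fun i => (C i).add_smul _ _ _ h1 h2 h3
  perp_smul := fun lam a b h1 h2 h i => (C i).perp_smul _ _ _ h1 h2 (h i)
  smul_oplus := fun lam a b h1 h2 h =>
    funext fun i => (C i).smul_oplus _ _ _ h1 h2 (h i)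
  one_smul := fun a => funext fun i => (C i).one_smul _
  seq_perp := fun a b c h i => (C i).seq_perp _ _ _ (h i)
  seq_oplus := fun a b c h => funext fun i => (C i).seq_oplus _ _ _ (h i)
  one_seq := fun a => funext fun i => (C i).one_seq _
  seq_eq_zero_comm := fun a b h =>
    funext fun i => (C i).seq_eq_zero_comm _ _ (congrFun h i)
  comm_compl := fun a b h => funext fun i => (C i).comm_compl _ _ (congrFun h i)
  comm_assoc := fun a b c h => funext fun i => (C i).comm_assoc _ _ _ (congrFun h i)
  comm_seq := fun a b c h1 h2 =>
    funext fun i => (C i).comm_seq _ _ _ (congrFun h1 i) (congrFun h2 i)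
  comm_oplus := fun a b c h1 h2 hp =>
    funext fun i => (C i).comm_oplus _ _ _ (congrFun h1 i) (congrFun h2 i) (hp i)
  smul_seq := fun lam a b h1 h2 => funext fun i => (C i).smul_seq _ _ _ h1 h2
  seq_smul := fun lam a b h1 h2 => funext fun i => (C i).seq_smul _ _ _ h1 h2

end COSEA

namespace COSEA

variable {E : Type u} {C : COSEA E}

theorem compl_compl (C : COSEA E) (a : E) : C.compl (C.compl a) = a := by
  have h := C.perp_comm _ _ (C.perp_compl a)
  exact (C.compl_unique _ _ h (by rw [C.oplus_comm _ _ h, C.oplus_compl])).symm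

theorem compl_one (C : COSEA E) : C.compl C.one = C.zero :=
  C.perp_one _ (C.perp_comm _ _ (C.perp_compl C.one))

theorem compl_zero (C : COSEA E) : C.compl C.zero = C.one := by
  rw [← C.compl_one, C.compl_compl]

theorem perp_zero (C : COSEA E) (a : E) : C.perp a C.zero := by
  have h1 : C.perp C.one C.zero := by simpa [C.compl_one] using C.perp_compl C.one
  have h := C.perp_compl (C.compl a)
  rw [C.compl_compl] at h
  have ho : C.oplus (C.compl a) a = C.one := by
    simpa [C.compl_compl] using C.oplus_compl (C.compl a)
  exact C.perp_assoc_right _ _ _ h (by rwa [ho])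

theorem oplus_zero (C : COSEA E) (a : E) : C.oplus a C.zero = a := by
  have h1 : C.perp C.one C.zero := by simpa [C.compl_one] using C.perp_compl C.one
  have h1o : C.oplus C.one C.zero = C.one := by
    simpa [C.compl_one] using C.oplus_compl C.one
  have h := C.perp_compl (C.compl a)
  rw [C.compl_compl] at h
  have ho : C.oplus (C.compl a) a = C.one := by
    simpa [C.compl_compl] using C.oplus_compl (C.compl a)
  have h2 : C.perp (C.oplus (C.compl a) a) C.zero := by rwa [ho]
  have := C.compl_unique _ _ (C.perp_assoc_left _ _ _ h h2)
    (by rw [C.oplus_assoc _ _ _ h h2, ho, h1o])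
  rwa [C.compl_compl] at this

theorem zero_oplus (C : COSEA E) (a : E) : C.oplus C.zero a = a := by
  rw [C.oplus_comm _ _ (C.perp_comm _ _ (C.perp_zero a)), C.oplus_zero]

theorem eq_compl_of_oplus {a b d : E} (h : C.perp a b) (hd : C.perp (C.oplus a b) d)
    (h1 : C.oplus (C.oplus a b) d = C.one) : b = C.compl (C.oplus a d) := by
  rw [C.oplus_comm _ _ h] at hd h1
  have h' := C.perp_comm _ _ h
  have hp := C.perp_assoc_left _ _ _ h' hd
  refine C.compl_unique _ _ (C.perp_comm _ _ hp) ?_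
  rw [← C.oplus_comm _ _ hp, C.oplus_assoc _ _ _ h' hd, h1]

theorem oplus_left_cancel {a b c : E} (hb : C.perp a b) (hc : C.perp a c)
    (h : C.oplus a b = C.oplus a c) : b = c := by
  rw [eq_compl_of_oplus hb (C.perp_compl _) (C.oplus_compl _),
    eq_compl_of_oplus hc (C.perp_compl _) (C.oplus_compl _), h]

theorem eq_zero_of_oplus_self {a : E} (h : C.perp a a) (h' : C.oplus a a = a) :
    a = C.zero :=
  oplus_left_cancel h (C.perp_zero a) (h'.trans (C.oplus_zero a).symm)

theorem eq_zero_of_le_zero {a : E} (h : C.le a C.zero) : a = C.zero := by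
  obtain ⟨c, hp, hc⟩ := h
  have h1 : C.perp (C.oplus c a) C.one := by
    rw [← C.oplus_comm _ _ hp, hc, ← C.compl_zero]
    exact C.perp_compl _
  exact C.perp_one _ (C.perp_assoc_right _ _ _ (C.perp_comm _ _ hp) h1)

theorem le_compl_of_perp {a b : E} (h : C.perp a b) : C.le b (C.compl a) := by
  have hd := C.perp_compl (C.oplus a b)
  refine ⟨_, C.perp_assoc_right _ _ _ h hd, ?_⟩
  exact C.compl_unique _ _ (C.perp_assoc_left _ _ _ h hd)
    (by rw [C.oplus_assoc _ _ _ h hd, C.oplus_compl])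

theorem seq_zero (C : COSEA E) (a : E) : C.seq a C.zero = C.zero := by
  have h := C.perp_zero C.zero
  refine eq_zero_of_oplus_self (C.seq_perp a _ _ h) ?_
  rw [← C.seq_oplus a _ _ h, C.oplus_zero]

theorem zero_seq (C : COSEA E) (a : E) : C.seq C.zero a = C.zero := by
  rw [C.seq_eq_zero_comm _ _ (C.seq_zero a), C.seq_zero]

theorem seq_one (C : COSEA E) (a : E) : C.seq a C.one = a := by
  have := C.comm_compl a C.zero (by rw [C.seq_zero, C.zero_seq])
  rwa [C.compl_zero, C.one_seq] at this

theorem seq_eq_zero_symm {a b : E} (h : C.seq a b = C.zero) : C.seq b a = C.zero :=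
  (C.seq_eq_zero_comm _ _ h).trans h

theorem zero_smul (C : COSEA E) (a : E) : C.smul 0 a = C.zero := by
  refine eq_zero_of_oplus_self
    (C.perp_smul_self 0 0 a le_rfl le_rfl (by norm_num)) ?_
  rw [← C.add_smul 0 0 a le_rfl le_rfl (by norm_num), add_zero]

theorem smul_zero (C : COSEA E) {r : ℝ} (h0 : 0 ≤ r) (h1 : r ≤ 1) :
    C.smul r C.zero = C.zero := by
  rw [← C.zero_smul C.zero, C.smul_smul _ _ _ h0 h1 le_rfl zero_le_one, mul_zero]

theorem seq_le_seq {b c : E} (a : E) (h : C.le b c) : C.le (C.seq a b) (C.seq a c) := by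
  obtain ⟨d, hp, rfl⟩ := h
  exact ⟨_, C.seq_perp a _ _ hp, (C.seq_oplus a _ _ hp).symm⟩

theorem seq_oplus_seq_compl (C : COSEA E) (a b : E) :
    C.oplus (C.seq a b) (C.seq a (C.compl b)) = a := by
  rw [← C.seq_oplus a _ _ (C.perp_compl b), C.oplus_compl, C.seq_one]

theorem seq_le_left (C : COSEA E) (a b : E) : C.le (C.seq a b) a :=
  ⟨_, C.seq_perp a _ _ (C.perp_compl b), C.seq_oplus_seq_compl a b⟩

theorem IsSharp.seq_compl {a : E} (h : C.IsSharp a) : C.seq a (C.compl a) = C.zero := by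
  refine eq_zero_of_le_zero (h _ (C.seq_le_left _ _) ?_)
  rw [C.comm_compl a a rfl]
  exact C.seq_le_left _ _

theorem IsSharp.seq_self {a : E} (h : C.IsSharp a) : C.seq a a = a := by
  have := C.seq_oplus_seq_compl a a
  rwa [h.seq_compl, C.oplus_zero] at this

theorem isSharp_of_seq_compl {a : E} (h : C.seq a (C.compl a) = C.zero) :
    C.IsSharp a := by
  intro c hca hca'
  have h1 : C.seq c a = C.zero := by
    refine seq_eq_zero_symm (eq_zero_of_le_zero ?_)
    rw [← h]
    exact seq_le_seq a hca'
  have h2 : C.seq c (C.compl a) = C.zero := by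
    refine seq_eq_zero_symm (eq_zero_of_le_zero ?_)
    rw [← seq_eq_zero_symm h]
    exact seq_le_seq _ hca
  have h3 := C.seq_oplus_seq_compl c a
  rw [h1, h2, C.oplus_zero] at h3
  exact ⟨C.zero, C.perp_zero _, by rw [C.oplus_zero, h3]⟩

theorem IsSharp.seq_eq_zero {a b : E} (h : C.IsSharp a) (hab : C.perp a b) :
    C.seq a b = C.zero := by
  refine eq_zero_of_le_zero ?_
  rw [← h.seq_compl]
  exact seq_le_seq a (le_compl_of_perp hab)

theorem seq_smul_comm {a b : E} {r : ℝ} (h0 : 0 ≤ r) (h1 : r ≤ 1)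
    (h : C.seq a b = C.seq b a) : C.seq a (C.smul r b) = C.seq (C.smul r b) a := by
  rw [C.seq_smul _ _ _ h0 h1, C.smul_seq _ _ _ h0 h1, h]

theorem SumList.unique {l : List E} {s t : E} (hs : C.SumList l s) (ht : C.SumList l t) :
    s = t := by
  induction hs generalizing t with
  | nil => cases ht; rfl
  | cons _ _ ih => cases ht with
    | cons h _ => rw [ih h]

theorem SumList.map_seq {l : List E} {s : E} (x : E) (h : C.SumList l s) :
    C.SumList (l.map (C.seq x)) (C.seq x s) := by
  induction h with
  | nil => rw [C.seq_zero]; exact .nil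
  | cons _ hp ih => rw [C.seq_oplus _ _ _ hp]; exact .cons ih (C.seq_perp _ _ _ hp)

theorem SumList.map_smul {l : List E} {s : E} {r : ℝ} (h0 : 0 ≤ r) (h1 : r ≤ 1)
    (h : C.SumList l s) : C.SumList (l.map (C.smul r)) (C.smul r s) := by
  induction h with
  | nil => rw [C.smul_zero h0 h1]; exact .nil
  | cons _ hp ih =>
    rw [C.smul_oplus _ _ _ h0 h1 hp]; exact .cons ih (C.perp_smul _ _ _ h0 h1 hp)

theorem SumList.comm {l : List E} {s x : E} (h : C.SumList l s)
    (hx : ∀ y ∈ l, C.seq x y = C.seq y x) : C.seq x s = C.seq s x := by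
  induction h with
  | nil => rw [C.seq_zero, C.zero_seq]
  | cons _ hp ih =>
    exact C.comm_oplus _ _ _ (hx _ (by simp)) (ih fun y hy => hx y (by simp [hy])) hp

theorem SumList.seq_eq_zero {l : List E} {s x : E} (h : C.SumList l s)
    (hx : ∀ y ∈ l, C.seq x y = C.zero) : C.seq x s = C.zero := by
  induction h with
  | nil => exact C.seq_zero x
  | cons _ hp ih =>
    rw [C.seq_oplus _ _ _ hp, hx _ (by simp), ih fun y hy => hx y (by simp [hy]),
      C.oplus_zero]

theorem SumList.seq_eq_single {ι : Type*} {f : ι → E} {l : List ι} {s x : E} {i : ι}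
    (h : C.SumList (l.map f) s) (hl : l.Nodup) (hi : i ∈ l)
    (hx : ∀ j, j ≠ i → C.seq x (f j) = C.zero) : C.seq x s = C.seq x (f i) := by
  induction l generalizing s with
  | nil => simp at hi
  | cons j l ih =>
    obtain ⟨hj, hl⟩ := List.nodup_cons.1 hl
    cases h with
    | cons h hp =>
      rw [C.seq_oplus _ _ _ hp]
      by_cases hij : i = j
      · subst hij
        rw [h.seq_eq_zero, C.oplus_zero]
        intro y hy
        obtain ⟨k, hk, rfl⟩ := List.mem_map.1 hy
        exact hx k (by rintro rfl; exact hj hk)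
      · rw [hx j (Ne.symm hij), ih h hl (by simpa [hij] using hi), C.zero_oplus]

theorem SumList.le {l : List E} {s x : E} (h : C.SumList l s) (hx : x ∈ l) :
    C.le x s := by
  induction h with
  | nil => simp at hx
  | @cons a l s h hp ih =>
    rcases List.mem_cons.1 hx with rfl | hx
    · exact ⟨s, hp, rfl⟩
    · obtain ⟨d, hd, rfl⟩ := ih hx
      have hd' := C.perp_comm _ _ hp
      refine ⟨C.oplus d a, C.perp_assoc_left _ _ _ hd hd', ?_⟩
      rw [C.oplus_assoc _ _ _ hd hd', C.oplus_comm _ _ hp]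

theorem perp_of_le {a b s : E} (h : C.perp a s) (hb : C.le b s) : C.perp a b := by
  obtain ⟨d, hd, rfl⟩ := hb
  rw [C.oplus_comm _ _ hd] at h
  exact C.perp_comm _ _
    (C.perp_assoc_right _ _ _ (C.perp_comm _ _ hd) (C.perp_comm _ _ h))

theorem SumList.pairwise {l : List E} {s : E} (h : C.SumList l s) :
    l.Pairwise C.perp := by
  induction h with
  | nil => exact .nil
  | cons h hp ih => exact .cons (fun y hy => perp_of_le hp (h.le hy)) ih

/-- A finite orthogonal sum splits along any decidable predicate on its indices. -/
theorem SumList.filter {ι : Type*} {f : ι → E} (p : ι → Bool) {l : List ι} {s : E}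
    (h : C.SumList (l.map f) s) :
    ∃ s₁ s₂, C.SumList ((l.filter p).map f) s₁ ∧
      C.SumList ((l.filter fun i => !p i).map f) s₂ ∧
      C.perp s₁ s₂ ∧ C.oplus s₁ s₂ = s := by
  induction l generalizing s with
  | nil => cases h; exact ⟨_, _, .nil, .nil, C.perp_zero _, C.oplus_zero _⟩
  | cons i l ih =>
    cases h with
    | cons h hp =>
      obtain ⟨s₁, s₂, h₁, h₂, h₁₂, rfl⟩ := ih h
      have key : ∀ x y, C.perp x y → C.perp (f i) (C.oplus x y) →
          C.perp (f i) x ∧ C.perp (C.oplus (f i) x) y ∧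
          C.oplus (C.oplus (f i) x) y = C.oplus (f i) (C.oplus x y) := by
        intro x y hxy hf
        have hfx : C.perp (f i) x := perp_of_le hf ⟨y, hxy, rfl⟩
        have hyx := C.perp_comm _ _ hxy
        have hf' : C.perp (C.oplus y x) (f i) := by
          rw [← C.oplus_comm _ _ hxy]; exact C.perp_comm _ _ hf
        have hp' := C.perp_assoc_left _ _ _ hyx hf'
        rw [← C.oplus_comm _ _ hfx] at hp'
        refine ⟨hfx, C.perp_comm _ _ hp', ?_⟩
        rw [← C.oplus_comm _ _ hp', C.oplus_comm _ _ hfx, C.oplus_assoc _ _ _ hyx hf',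
          ← C.oplus_comm _ _ hxy, C.oplus_comm _ _ hf]
      cases hpi : p i
      · obtain ⟨k1, k2, k3⟩ := key s₂ s₁ (C.perp_comm _ _ h₁₂)
          (by rwa [← C.oplus_comm _ _ h₁₂])
        refine ⟨s₁, C.oplus (f i) s₂, by simpa [hpi] using h₁, ?_,
          C.perp_comm _ _ k2, ?_⟩
        · simpa [hpi] using SumList.cons h₂ k1
        · rw [← C.oplus_comm _ _ k2, k3, ← C.oplus_comm _ _ h₁₂]
      · obtain ⟨k1, k2, k3⟩ := key s₁ s₂ h₁₂ hp
        refine ⟨C.oplus (f i) s₁, s₂, ?_, by simpa [hpi] using h₂, k2, k3⟩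
        simpa [hpi] using SumList.cons h₁ k1

variable {ω : E → ℝ}

theorem IsState.map_zero (hω : C.IsState ω) : ω C.zero = 0 := by
  have h := hω.2.2 _ _ (C.perp_zero C.zero)
  rw [C.oplus_zero] at h
  linarith

theorem IsState.mono (hω : C.IsState ω) {a b : E} (h : C.le a b) : ω a ≤ ω b := by
  obtain ⟨c, hp, rfl⟩ := h
  rw [hω.2.2 _ _ hp]
  linarith [(hω.1 c).1]

theorem IsState.map_compl (hω : C.IsState ω) (a : E) : ω (C.compl a) = 1 - ω a := by
  have h := hω.2.2 _ _ (C.perp_compl a)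
  rw [C.oplus_compl, hω.2.1] at h
  linarith

theorem IsState.map_sumList (hω : C.IsState ω) {l : List E} {s : E}
    (h : C.SumList l s) : ω s = (l.map ω).sum := by
  induction h with
  | nil => simpa using hω.map_zero
  | cons _ hp ih => rw [hω.2.2 _ _ hp, ih]; simp

/-- A bounded additive function on `[0,1]` is linear, so states are homogeneous. -/
theorem IsState.map_smul (hω : C.IsState ω) (a : E) {r : ℝ} (h0 : 0 ≤ r) (h1 : r ≤ 1) :
    ω (C.smul r a) = r * ω a := by
  have hadd : ∀ s t : ℝ, 0 ≤ s → 0 ≤ t → s + t ≤ 1 →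
      ω (C.smul (s + t) a) = ω (C.smul s a) + ω (C.smul t a) := fun s t hs ht hst => by
    rw [C.add_smul _ _ _ hs ht hst, hω.2.2 _ _ (C.perp_smul_self _ _ _ hs ht hst)]
  have hhalf : ω (C.smul (1 / 2) a) = 1 / 2 * ω a := by
    have h := hadd (1 / 2) (1 / 2) (by norm_num) (by norm_num) (by norm_num)
    norm_num [C.one_smul] at h ⊢
    linarith
  have key : ∀ (n : ℕ) (t : ℝ), 0 ≤ t → t ≤ 1 →
      |ω (C.smul t a) - t * ω a| ≤ (1 / 2) ^ n := by
    intro n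
    induction n with
    | zero =>
      intro t ht0 ht1
      obtain ⟨ha0, ha1⟩ := hω.1 a
      obtain ⟨hb0, hb1⟩ := hω.1 (C.smul t a)
      rw [pow_zero, abs_le]
      constructor <;> nlinarith
    | succ n ih =>
      intro t ht0 ht1
      rcases le_total t (1 / 2) with ht | ht
      · have h := hadd t t ht0 ht0 (by linarith)
        have h' := ih (t + t) (by linarith) (by linarith)
        rw [h, abs_le] at h'
        rw [pow_succ, abs_le]
        constructor <;> linarith [h'.1, h'.2]
      · have h := hadd (t - 1 / 2) (t - 1 / 2) (by linarith) (by linarith) (by linarith)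
        have h2 := hadd (t - 1 / 2) (1 / 2) (by linarith) (by linarith) (by linarith)
        rw [sub_add_cancel, hhalf] at h2
        have h' := ih (t - 1 / 2 + (t - 1 / 2)) (by linarith) (by linarith)
        rw [h, abs_le] at h'
        rw [pow_succ, abs_le]
        constructor <;> linarith [h'.1, h'.2]
  have hlim : Filter.Tendsto (fun n : ℕ => (1 / 2 : ℝ) ^ n) Filter.atTop (nhds 0) :=
    tendsto_pow_atTop_nhds_zero_of_lt_one (by norm_num) (by norm_num)
  have hle := ge_of_tendsto' hlim fun n => key n r h0 h1
  exact sub_eq_zero.1 (abs_nonpos_iff.1 hle)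

theorem IsState.eq_zero_of_seq_eq_zero (hω : C.IsState ω) {a c : E}
    (hac : C.seq a c = C.zero) (ha : ω a = 1) : ω c = 0 := by
  have hca := seq_eq_zero_symm hac
  have hc := C.seq_oplus_seq_compl c a
  rw [hca, C.zero_oplus, C.comm_compl c a (by rw [hca, hac])] at hc
  have h := hω.mono (C.seq_le_left (C.compl a) c)
  rw [hc, hω.map_compl, ha] at h
  linarith [(hω.1 c).1]

theorem IsState.map_seq_self_of_constant_ae (hω : C.IsState ω) {a c : E} {r : ℝ}
    (h0 : 0 ≤ r) (h1 : r ≤ 1) (hs : C.IsSharp a) (hp : C.perp (C.smul r a) c)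
    (hac : C.seq a c = C.zero) (ha : ω a = 1) :
    ω (C.seq (C.oplus (C.smul r a) c) (C.oplus (C.smul r a) c)) =
      ω (C.oplus (C.smul r a) c) ^ 2 := by
  have hca := seq_eq_zero_symm hac
  have hωc := hω.eq_zero_of_seq_eq_zero hac ha
  have hab := C.comm_oplus (C.smul r a) c a (seq_smul_comm h0 h1 rfl)
    (by rw [hac, hca]) hp
  have hcb := C.comm_oplus (C.smul r a) c c (seq_smul_comm h0 h1 (by rw [hac, hca]))
    rfl hp
  have hab' : C.seq a (C.oplus (C.smul r a) c) = C.smul r a := by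
    rw [C.seq_oplus _ _ _ hp, hac, C.oplus_zero, C.seq_smul _ _ _ h0 h1, hs.seq_self]
  have hωcb : ω (C.seq c (C.oplus (C.smul r a) c)) = 0 :=
    le_antisymm (hωc ▸ hω.mono (C.seq_le_left _ _)) (hω.1 _).1
  have hωb : ω (C.oplus (C.smul r a) c) = r := by
    rw [hω.2.2 _ _ hp, hω.map_smul a h0 h1, ha, hωc]; ring
  rw [C.seq_oplus _ _ _ hp, hω.2.2 _ _ (C.seq_perp _ _ _ hp), ← hcb, hωcb,
    C.seq_smul _ _ _ h0 h1, ← hab, hab', hω.map_smul _ h0 h1, hω.map_smul _ h0 h1, ha,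
    hωb]
  ring

theorem IsContextFun.seq_eq_zero {n : ℕ} {a : Fin n → E} (ha : C.IsContextFun a)
    {i j : Fin n} (hij : i ≠ j) : C.seq (a i) (a j) = C.zero := by
  have hpw := List.pairwise_ofFn.1 ha.2.2.pairwise
  rcases lt_or_gt_of_ne hij with h | h
  · exact (ha.2.1 i).1.seq_eq_zero (hpw h)
  · exact seq_eq_zero_symm ((ha.2.1 j).1.seq_eq_zero (hpw h))

theorem IsContextFun.seq_eq_smul {n : ℕ} {a : Fin n → E} {r : Fin n → ℝ} {b : E}
    (ha : C.IsContextFun a) (hb : C.SpanRep a r b) (i : Fin n) :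
    C.seq b (a i) = C.smul (r i) (a i) := by
  obtain ⟨hr, hb⟩ := hb
  have hcomm : C.seq (a i) b = C.seq b (a i) := by
    refine hb.comm fun y hy => ?_
    obtain ⟨j, rfl⟩ := (List.mem_ofFn' _ _).1 hy
    refine seq_smul_comm (hr j).1 (hr j).2 ?_
    by_cases hij : i = j
    · rw [hij]
    · rw [ha.seq_eq_zero hij, ha.seq_eq_zero (Ne.symm hij)]
  rw [List.ofFn_eq_map] at hb
  rw [← hcomm, hb.seq_eq_single (List.nodup_finRange n) (List.mem_finRange i),
    C.seq_smul _ _ _ (hr i).1 (hr i).2, (ha.2.1 i).1.seq_self]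
  intro j hji
  rw [C.seq_smul _ _ _ (hr j).1 (hr j).2, ha.seq_eq_zero (Ne.symm hji),
    C.smul_zero (hr j).1 (hr j).2]

theorem IsContextFun.sum_state_eq_one (hω : C.IsState ω) {n : ℕ} {a : Fin n → E}
    (ha : C.IsContextFun a) : ∑ i, ω (a i) = 1 := by
  rw [← hω.2.1, hω.map_sumList ha.2.2, List.map_ofFn, List.sum_ofFn]
  rfl

theorem SpanRep.state_eq (hω : C.IsState ω) {n : ℕ} {a : Fin n → E} {r : Fin n → ℝ}
    {b : E} (hb : C.SpanRep a r b) : ω b = ∑ i, r i * ω (a i) := by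
  rw [hω.map_sumList hb.2, List.map_ofFn, List.sum_ofFn]
  exact Finset.sum_congr rfl fun i _ => hω.map_smul _ (hb.1 i).1 (hb.1 i).2

theorem IsContextFun.state_seq_self_eq (hω : C.IsState ω) {n : ℕ} {a : Fin n → E}
    {r : Fin n → ℝ} {b : E} (ha : C.IsContextFun a) (hb : C.SpanRep a r b) :
    ω (C.seq b b) = ∑ i, r i ^ 2 * ω (a i) := by
  rw [hω.map_sumList (hb.2.map_seq b), List.map_ofFn, List.map_ofFn, List.sum_ofFn]
  refine Finset.sum_congr rfl fun i _ => ?_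
  obtain ⟨h0, h1⟩ := hb.1 i
  simp only [Function.comp_apply]
  rw [C.seq_smul _ _ _ h0 h1, ha.seq_eq_smul hb, hω.map_smul _ h0 h1,
    hω.map_smul _ h0 h1]
  ring

/-- The coefficients of a dispersion-free effect equal its mean off an `ω`-null set. -/
theorem IsContextFun.coeff_eq_of_dispersion_free (hω : C.IsState ω) {n : ℕ}
    {a : Fin n → E} {r : Fin n → ℝ} {b : E} (ha : C.IsContextFun a)
    (hb : C.SpanRep a r b) (h : ω (C.seq b b) = ω b ^ 2) {i : Fin n}
    (hi : r i ≠ ω b) : ω (a i) = 0 := by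
  have hvar : ∑ i, (r i - ω b) ^ 2 * ω (a i) = 0 := by
    have hexp : ∀ i, (r i - ω b) ^ 2 * ω (a i) =
        r i ^ 2 * ω (a i) - 2 * ω b * (r i * ω (a i)) + ω b ^ 2 * ω (a i) :=
      fun i => by ring
    simp only [hexp, Finset.sum_add_distrib, Finset.sum_sub_distrib, ← Finset.mul_sum]
    rw [← ha.state_seq_self_eq hω hb, ← hb.state_eq hω, ha.sum_state_eq_one hω, h]
    ring
  rw [Finset.sum_eq_zero_iff_of_nonneg
    fun i _ => mul_nonneg (sq_nonneg _) (hω.1 _).1] at hvar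
  exact (mul_eq_zero.1 (hvar i (Finset.mem_univ i))).resolve_left
    (pow_ne_zero 2 (sub_ne_zero.2 hi))

theorem IsContextFun.exists_constant_ae (hω : C.IsState ω) {n : ℕ} {a : Fin n → E}
    {r : Fin n → ℝ} {b : E} (ha : C.IsContextFun a) (hb : C.SpanRep a r b)
    (h : ω (C.seq b b) = ω b ^ 2) :
    ∃ e c : E, C.IsSharp e ∧ C.perp (C.smul (ω b) e) c ∧
      C.oplus (C.smul (ω b) e) c = b ∧ C.seq e c = C.zero ∧ ω e = 1 := by
  classical
  have h1 := ha.2.2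
  have h2 := hb.2
  rw [List.ofFn_eq_map] at h1 h2
  obtain ⟨e, d, he, hd, hed, hed1⟩ := h1.filter fun i => decide (r i = ω b)
  obtain ⟨e', c, he', hc, hec, hecb⟩ := h2.filter fun i => decide (r i = ω b)
  have hd_eq : d = C.compl e := C.compl_unique _ _ hed hed1
  have hzero : ∀ i, r i ≠ ω b → C.seq e (a i) = C.zero := by
    intro i hi
    refine seq_eq_zero_symm (he.seq_eq_zero fun y hy => ?_)
    obtain ⟨j, hj, rfl⟩ := List.mem_map.1 hy
    have hj : r j = ω b := by simpa using hj
    exact ha.seq_eq_zero (by rintro rfl; exact hi hj)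
  have hsmul : e' = C.smul (ω b) e := by
    refine he'.unique ?_
    have := he.map_smul (hω.1 b).1 (hω.1 b).2
    rw [List.map_map] at this
    convert this using 1
    refine List.map_congr_left fun i hi => ?_
    have hi : r i = ω b := by simpa using hi
    simp [hi]
  subst hsmul
  refine ⟨e, c, isSharp_of_seq_compl ?_, hec, hecb, ?_, ?_⟩
  · rw [← hd_eq]
    refine hd.seq_eq_zero fun y hy => ?_
    obtain ⟨i, hi, rfl⟩ := List.mem_map.1 hy
    exact hzero i (by simpa using hi)
  · refine hc.seq_eq_zero fun y hy => ?_
    obtain ⟨i, hi, rfl⟩ := List.mem_map.1 hy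
    rw [C.seq_smul _ _ _ (hb.1 i).1 (hb.1 i).2, hzero i (by simpa using hi),
      C.smul_zero (hb.1 i).1 (hb.1 i).2]
  · have hωd : ω d = 0 := by
      rw [hω.map_sumList hd]
      refine List.sum_eq_zero fun x hx => ?_
      obtain ⟨y, hy, rfl⟩ := List.mem_map.1 hx
      obtain ⟨i, hi, rfl⟩ := List.mem_map.1 hy
      exact ha.coeff_eq_of_dispersion_free hω hb h (by simpa using hi)
    rw [hd_eq, hω.map_compl] at hωd
    linarith

end COSEA

/-- `b` is dispersion-free relative to `ω` iff `b` is constant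
almost everywhere `ω`. -/
theorem dispersion_free_iff_constant_ae {E : Type u} (C : COSEA E)
    (hFD : C.FinDim) (hSp : C.Spectral) (b : E) (ω : E → ℝ) (hω : C.IsState ω) :
    ω (C.seq b b) = (ω b) ^ 2 ↔
      ∃ (lam : ℝ) (a c : E), 0 ≤ lam ∧ lam ≤ 1 ∧ C.IsSharp a ∧
        C.perp (C.smul lam a) c ∧ C.oplus (C.smul lam a) c = b ∧
        C.seq a c = C.zero ∧ ω a = 1 := by
  constructor
  · intro h
    obtain ⟨-, -, n, a, r, ha, -, hb⟩ := hSp.2 b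
    obtain ⟨e, c, H⟩ := ha.exists_constant_ae hω hb h
    exact ⟨ω b, e, c, (hω.1 b).1, (hω.1 b).2, H⟩
  · rintro ⟨r, a, c, h0, h1, hs, hp, rfl, hac, ha⟩
    exact hω.map_seq_self_of_constant_ae h0 h1 hs hp hac ha
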